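/- Let N ≥ 1, 1 < p < ∞, and let π_p = 2 ∫_0^1 ((p−1)/(1−t^p))^{1/p} dt. For every ε > 0, the infimum of the Rayleigh quotient ∫_{B(0,ε)} |∇u(x)|^p dx / ∫_{B(0,ε)} |x|^{1−N} |u(x)|^p dx, taken over all C^1 functions u, not identically zero, with compact support contained in the ball B(0,ε) ⊂ ℝ^N, is at most π_p^p · ε^{N−1−p}. -/

import Mathlib

open MeasureTheory Metric

lemma aux_pi (p : ℝ) (hp : 1 < p) :
    1 ≤ ∫ t in (0:ℝ)..1, ((p - 1) / (1 - t ^ p)) ^ (1 / p) := by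
  have hp0 : 0 < p := by linarith
  have hip : 1 / p < 1 := by rw [div_lt_one hp0]; exact hp
  have hip0 : 0 < 1 / p := by positivity
  have hbase : IntervalIntegrable (fun t : ℝ => (1 - t) ^ (-(1 / p))) volume 0 1 := by
    have h := (intervalIntegral.intervalIntegrable_rpow' (a := 0) (b := 1) (r := -(1/p))
      (by linarith)).comp_sub_left 1
    simpa using h.symm
  have hint : ∫ t in (0:ℝ)..1, (1 - t) ^ (-(1 / p)) = p / (p - 1) := by
    rw [intervalIntegral.integral_comp_sub_left (fun t : ℝ => t ^ (-(1/p))) 1,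
      integral_rpow (Or.inl (by linarith))]
    have h1 : -(1 / p) + 1 ≠ 0 := by linarith
    simp only [sub_self, sub_zero, Real.one_rpow, Real.zero_rpow h1]
    have : p - 1 ≠ 0 := by linarith
    have h2 : -(1 / p) + 1 = (p - 1) / p := by field_simp; ring
    rw [h2, one_div_div]
  have hupper : ∀ t ∈ Set.Ioo (0:ℝ) 1, 1 - t ≤ 1 - t ^ p := by
    intro t ht
    have := Real.rpow_le_rpow_of_exponent_ge ht.1 ht.2.le hp.le
    rw [Real.rpow_one] at this
    linarith
  have hlower : ∀ t ∈ Set.Ioo (0:ℝ) 1, 1 - t ^ p ≤ p * (1 - t) := by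
    intro t ht
    have := one_add_mul_self_le_rpow_one_add (s := t - 1) (by linarith [ht.1]) hp.le
    have e : 1 + (t - 1) = t := by ring
    rw [e] at this
    linarith
  have hI : IntervalIntegrable (fun t : ℝ => ((p - 1) / (1 - t ^ p)) ^ (1 / p)) volume 0 1 := by
    have hb := hbase.const_mul ((p - 1) ^ (1 / p))
    rw [intervalIntegrable_iff_integrableOn_Ioo_of_le zero_le_one] at hb ⊢
    refine hb.mono' (Measurable.aestronglyMeasurable (by fun_prop)) ?_
    filter_upwards [ae_restrict_mem measurableSet_Ioo] with t ht
    have h1 := hupper t ht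
    have h2 : 0 < 1 - t := by linarith [ht.2]
    rw [Real.norm_of_nonneg (by
      apply Real.rpow_nonneg
      apply div_nonneg <;> linarith), Real.rpow_neg h2.le, ← div_eq_mul_inv,
      ← Real.div_rpow (by linarith) h2.le]
    apply Real.rpow_le_rpow
    · apply div_nonneg <;> linarith
    · apply div_le_div_of_nonneg_left <;> linarith
    · exact hip0.le
  have hmono : ∫ t in (0:ℝ)..1, ((p - 1) / p) ^ (1 / p) * (1 - t) ^ (-(1 / p)) ≤
      ∫ t in (0:ℝ)..1, ((p - 1) / (1 - t ^ p)) ^ (1 / p) := by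
    apply intervalIntegral.integral_mono_on_of_le_Ioo zero_le_one (hbase.const_mul _) hI
    intro t ht
    have h1 := hupper t ht
    have h3 := hlower t ht
    have h2 : 0 < 1 - t := by linarith [ht.2]
    rw [Real.rpow_neg h2.le, ← div_eq_mul_inv,
      ← Real.div_rpow (by apply div_nonneg <;> linarith) h2.le, div_div]
    apply Real.rpow_le_rpow
    · apply div_nonneg
      · linarith
      · positivity
    · apply div_le_div_of_nonneg_left <;> linarith
    · exact hip0.le
  refine le_trans ?_ hmono
  rw [intervalIntegral.integral_const_mul, hint]
  have hq : 0 < (p - 1) / p := div_pos (by linarith) hp0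
  have hq1 : (p - 1) / p ≤ 1 := by rw [div_le_one hp0]; linarith
  have : (p - 1) / p ≤ ((p - 1) / p) ^ (1 / p) := by
    have := Real.rpow_le_rpow_of_exponent_ge hq hq1 hip.le
    rwa [Real.rpow_one] at this
  calc (1:ℝ) = (p - 1) / p * (p / (p - 1)) := by
        have : p - 1 ≠ 0 := by linarith
        field_simp
    _ ≤ _ := by
        apply mul_le_mul_of_nonneg_right this
        apply div_nonneg <;> linarith

lemma aux_psi (δ : ℝ) (hδ : 0 < δ) : ∃ ψ : ℝ → ℝ, ContDiff ℝ 1 ψ ∧ LipschitzWith 1 ψ ∧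
    (∀ t ≤ 0, ψ t = 0) ∧ (∀ t, 0 ≤ ψ t) ∧ ∀ t, t - δ ≤ ψ t := by
  set g : ℝ → ℝ := fun s => min 1 (max 0 (s / δ)) with hg
  have hgc : Continuous g := by fun_prop
  have hg0 : ∀ s, 0 ≤ g s := fun s => le_min zero_le_one (le_max_left _ _)
  have hg1 : ∀ s, g s ≤ 1 := fun s => min_le_left _ _
  have hgn : ∀ s ≤ 0, g s = 0 := by
    intro s hs
    have : s / δ ≤ 0 := div_nonpos_of_nonpos_of_nonneg hs hδ.le
    simp [hg, max_eq_left this]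
  have hgd : ∀ s, δ ≤ s → g s = 1 := by
    intro s hs
    have : 1 ≤ s / δ := by rwa [one_le_div hδ]
    simp [hg, this]
  have hd : ∀ t, HasDerivAt (fun t => ∫ s in (0:ℝ)..t, g s) (g t) t := fun t =>
    intervalIntegral.integral_hasDerivAt_right (hgc.intervalIntegrable _ _)
      hgc.stronglyMeasurable.stronglyMeasurableAtFilter hgc.continuousAt
  have hde : deriv (fun t => ∫ s in (0:ℝ)..t, g s) = g := funext fun t => (hd t).deriv
  have hneg : ∀ t ≤ (0:ℝ), ∫ s in (0:ℝ)..t, g s = 0 := by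
    intro t ht
    rw [intervalIntegral.integral_symm, neg_eq_zero]
    rw [intervalIntegral.integral_congr (g := fun _ => (0:ℝ))]
    · simp
    · intro s hs
      rw [Set.uIcc_of_le ht] at hs
      exact hgn s hs.2
  have hnn : ∀ t, 0 ≤ ∫ s in (0:ℝ)..t, g s := by
    intro t
    rcases le_total t 0 with h | h
    · exact (hneg t h).ge
    · exact intervalIntegral.integral_nonneg h fun s _ => hg0 s
  refine ⟨fun t => ∫ s in (0:ℝ)..t, g s, ?_, ?_, hneg, hnn, ?_⟩
  · rw [contDiff_one_iff_deriv]
    exact ⟨fun t => (hd t).differentiableAt, by rw [hde]; exact hgc⟩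
  · apply lipschitzWith_of_nnnorm_deriv_le (fun t => (hd t).differentiableAt)
    intro t
    rw [hde, ← NNReal.coe_le_coe]
    simpa [abs_of_nonneg (hg0 t)] using hg1 t
  · intro t
    rcases le_total t δ with h | h
    · exact le_trans (by linarith) (hnn t)
    · have h1 := intervalIntegral.integral_add_adjacent_intervals
        (hgc.intervalIntegrable (μ := volume) 0 δ) (hgc.intervalIntegrable δ t)
      have h2 : ∫ s in δ..t, g s = t - δ := by
        rw [intervalIntegral.integral_congr (g := fun _ => (1:ℝ))]
        · simp
        · intro s hs
          rw [Set.uIcc_of_le h] at hs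
          exact hgd s hs.1
      have h3 := hnn δ
      show t - δ ≤ ∫ s in (0:ℝ)..t, g s
      linarith

lemma aux_sqrt (δ a b : ℝ) :
    |√(a^2 + δ^2) - √(b^2+δ^2)| ≤ |a - b| := by
  have e : ∀ c : ℝ, √(c^2+δ^2) = ‖(WithLp.toLp 2 (c, δ) : WithLp 2 (ℝ × ℝ))‖ := by
    intro c
    rw [WithLp.prod_norm_eq_of_L2]
    simp
  rw [e, e]
  refine (abs_norm_sub_norm_le _ _).trans ?_
  rw [← WithLp.toLp_sub, WithLp.prod_norm_eq_of_L2]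
  simp [Real.sqrt_sq_eq_abs]

lemma aux_u {E : Type*} [NormedAddCommGroup E] [InnerProductSpace ℝ E] [FiniteDimensional ℝ E]
    (ε ρ : ℝ) (hρ : 0 < ρ) (hε : ρ < ε) : ∃ u : E → ℝ, ContDiff ℝ 1 u ∧
    HasCompactSupport u ∧ tsupport u ⊆ ball (0 : E) ε ∧ (∀ x, ‖fderiv ℝ u x‖ ≤ 1) ∧
    (∀ x, 0 ≤ u x) ∧ ∀ x, ρ - ‖x‖ ≤ u x := by
  obtain ⟨δ, hδ, hδe⟩ : ∃ δ : ℝ, 0 < δ ∧ ρ = ε - 3 * δ := ⟨(ε - ρ) / 3, by linarith, by ring⟩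
  obtain ⟨ψ, h1, h2, h3, h4, h5⟩ := aux_psi δ hδ
  have hs : tsupport (fun x : E => ψ (ε - δ - √(‖x‖^2 + δ^2))) ⊆ closedBall (0:E) (ε - δ) := by
    apply closure_minimal _ isClosed_closedBall
    intro x hx
    rw [mem_closedBall_zero_iff]
    by_contra! hc
    apply hx
    apply h3
    have : ‖x‖ ≤ √(‖x‖^2 + δ^2) := Real.le_sqrt_of_sq_le (by nlinarith)
    linarith
  refine ⟨fun x => ψ (ε - δ - √(‖x‖^2 + δ^2)), ?_, ?_, ?_, ?_, fun x => h4 _, ?_⟩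
  · apply h1.comp
    apply contDiff_const.sub
    apply ContDiff.sqrt
    · exact (contDiff_norm_sq ℝ).add contDiff_const
    · intro x; positivity
  · exact HasCompactSupport.of_support_subset_isCompact (isCompact_closedBall 0 (ε - δ))
      (subset_closure.trans hs)
  · exact hs.trans (closedBall_subset_ball (by linarith))
  · intro x
    have hl : LipschitzWith 1 (fun x : E => ψ (ε - δ - √(‖x‖^2 + δ^2))) := by
      have : LipschitzWith 1 (fun x : E => ε - δ - √(‖x‖^2 + δ^2)) := by
        apply LipschitzWith.of_dist_le_mul
        intro x y
        rw [Real.dist_eq, NNReal.coe_one, one_mul, dist_eq_norm]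
        have := aux_sqrt δ ‖y‖ ‖x‖
        have h' := abs_norm_sub_norm_le y x
        rw [norm_sub_rev]
        refine le_trans (le_of_eq ?_) (this.trans h')
        congr 1; ring
      have h := h2.comp this
      rw [one_mul] at h
      exact h
    simpa using norm_fderiv_le_of_lipschitz ℝ hl (x₀ := x)
  · intro x
    refine le_trans ?_ (h5 _)
    have : √(‖x‖^2 + δ^2) ≤ ‖x‖ + δ := by
      apply Real.sqrt_le_left (by positivity) |>.mpr
      nlinarith [norm_nonneg x]
    linarith

/-- Upper bound for the first Dirichlet eigenvalue of `-Δ_p u = λ |x|^{1-N} |u|^{p-2} u`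
on the ball `B(0,ε)`: the infimum of the Rayleigh quotient is at most
`π_p^p · ε^(N-1-p)`, where `π_p = 2∫₀¹ ((p-1)/(1-t^p))^(1/p) dt`. -/
theorem rayleigh_quotient_upper_bound_ball (N : ℕ) (hN : 1 ≤ N) (p : ℝ) (hp : 1 < p)
    (ε : ℝ) (hε : 0 < ε) :
    sInf {R : ℝ | ∃ u : EuclideanSpace ℝ (Fin N) → ℝ,
        ContDiff ℝ 1 u ∧ HasCompactSupport u ∧
        tsupport u ⊆ ball (0 : EuclideanSpace ℝ (Fin N)) ε ∧ u ≠ 0 ∧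
        R = (∫ x in ball (0 : EuclideanSpace ℝ (Fin N)) ε, ‖fderiv ℝ u x‖ ^ p) /
            (∫ x in ball (0 : EuclideanSpace ℝ (Fin N)) ε, ‖x‖ ^ (1 - (N : ℝ)) * |u x| ^ p)}
      ≤ (2 * ∫ t in (0:ℝ)..1, ((p - 1) / (1 - t ^ p)) ^ (1 / p)) ^ p *
          ε ^ ((N : ℝ) - 1 - p) := by
  set E := EuclideanSpace ℝ (Fin N) with hE
  have hp0 : 0 < p := by linarith
  have h2p : p + 1 < 2 ^ p := by
    have := one_add_mul_self_lt_rpow_one_add (s := 1) (by norm_num) one_ne_zero hp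
    norm_num at this
    linarith
  have h2p0 : (0:ℝ) < 2 ^ p := by positivity
  -- the radius of the tent function
  obtain ⟨ρ, hρ, hρε, hρp⟩ : ∃ ρ : ℝ, 0 < ρ ∧ ρ < ε ∧
      (p + 1) * ε ^ (p + 1) = 2 ^ p * ρ ^ (p + 1) := by
    refine ⟨ε * ((p + 1) / 2 ^ p) ^ (1 / (p + 1)), by positivity, ?_, ?_⟩
    · have : ((p + 1) / 2 ^ p) ^ (1 / (p + 1)) < 1 :=
        Real.rpow_lt_one (by positivity) ((div_lt_one h2p0).2 h2p) (by positivity)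
      nlinarith
    · rw [Real.mul_rpow hε.le (by positivity), ← Real.rpow_mul (by positivity),
        one_div_mul_cancel (by positivity), Real.rpow_one]
      field_simp
  obtain ⟨u, hu1, hu2, hu3, hu4, hu5, hu6⟩ := aux_u (E := E) ε ρ hρ hρε
  set ω : ℝ := (volume : Measure E).real (ball 0 1) with hω
  have hω0 : 0 < ω := by
    rw [hω, measureReal_def]
    exact ENNReal.toReal_pos (measure_ball_pos _ _ one_pos).ne' measure_ball_lt_top.ne
  have hfin : Module.finrank ℝ E = N := finrank_euclideanSpace_fin
  have : Nonempty (Fin N) := ⟨⟨0, hN⟩⟩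
  have : Nontrivial E := Module.nontrivial_of_finrank_pos (R := ℝ) (by omega)
  have hNpos : (0:ℝ) < N := by exact_mod_cast hN
  -- numerator
  have hnum : (∫ x in ball (0 : E) ε, ‖fderiv ℝ u x‖ ^ p) ≤ ε ^ N * ω := by
    have h := norm_setIntegral_le_of_norm_le_const (μ := volume) (s := ball (0:E) ε)
      (f := fun x => ‖fderiv ℝ u x‖ ^ p) (C := 1) measure_ball_lt_top (by
        intro x _
        rw [Real.norm_of_nonneg (by positivity)]
        exact Real.rpow_le_one (norm_nonneg _) (hu4 x) hp0.le)
    rw [one_mul] at h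
    refine (le_abs_self _).trans (h.trans (le_of_eq ?_))
    rw [measureReal_def, Measure.addHaar_ball _ _ hε.le, ENNReal.toReal_mul, hfin,
      ENNReal.toReal_ofReal (by positivity), hω, measureReal_def]
  -- denominator
  set g : ℝ → ℝ := fun r => r ^ (1 - (N:ℝ)) * (max (ρ - r) 0) ^ p with hg
  have hgint : ∫ x : E, g ‖x‖ = N * (ω * (ρ ^ (p + 1) / (p + 1))) := by
    rw [integral_fun_norm_addHaar, hfin, nsmul_eq_mul, smul_eq_mul]
    congr 2
    have e1 : ∫ y in Set.Ioi (0:ℝ), y ^ (N - 1) • g y =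
        ∫ y in Set.Ioi (0:ℝ), (max (ρ - y) 0) ^ p := by
      apply setIntegral_congr_fun measurableSet_Ioi
      intro y hy
      have hy : 0 < y := hy
      simp only [hg, smul_eq_mul]
      rw [← mul_assoc, ← Real.rpow_natCast, ← Real.rpow_add hy, Nat.cast_sub hN]
      simp
    have e2 : ∫ y in Set.Ioi (0:ℝ), (max (ρ - y) 0) ^ p =
        ∫ y in Set.Ioc (0:ℝ) ρ, (max (ρ - y) 0) ^ p := by
      apply setIntegral_eq_of_subset_of_forall_sdiff_eq_zero measurableSet_Ioi
      · exact Set.Ioc_subset_Ioi_self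
      · rintro y ⟨hy, hy'⟩
        have hy : 0 < y := hy
        have : ρ < y := by
          by_contra! hc
          exact hy' ⟨hy, hc⟩
        rw [max_eq_right (by linarith), Real.zero_rpow hp0.ne']
    have e3 : ∫ y in Set.Ioc (0:ℝ) ρ, (max (ρ - y) 0) ^ p = ∫ y in (0:ℝ)..ρ, (ρ - y) ^ p := by
      rw [intervalIntegral.integral_of_le hρ.le]
      apply setIntegral_congr_fun measurableSet_Ioc
      intro y hy
      have := hy.2
      simp only
      rw [max_eq_left (by linarith)]
    rw [e1, e2, e3, intervalIntegral.integral_comp_sub_left (fun t : ℝ => t ^ p) ρ,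
      integral_rpow (Or.inl (by linarith))]
    simp [Real.zero_rpow (by linarith : p + 1 ≠ 0)]
  have hgball : ∫ x in ball (0:E) ε, g ‖x‖ = ∫ x : E, g ‖x‖ := by
    apply setIntegral_eq_integral_of_forall_compl_eq_zero
    intro x hx
    rw [mem_ball_zero_iff, not_lt] at hx
    simp only [hg]
    rw [max_eq_right (by linarith), Real.zero_rpow hp0.ne', mul_zero]
  obtain ⟨C, hC⟩ := hu2.exists_bound_of_continuous hu1.continuous
  have hInt : IntegrableOn (fun x : E => ‖x‖ ^ (1 - (N:ℝ)) * |u x| ^ p) (ball (0:E) ε) := by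
    have hloc : LocallyIntegrable (fun x : E => ‖x‖ ^ (1 - (N:ℝ)) * |u x| ^ p) volume := by
      refine locallyIntegrable_of_norm_le_rpow (C := C ^ p) (α := (N:ℝ) - 1)
        (by rw [hfin]; exact hN) (by rw [hfin]; linarith) ?_ ?_
      · refine Filter.Eventually.of_forall fun x => ?_
        rw [Real.norm_of_nonneg (by positivity), neg_sub, mul_comm]
        apply mul_le_mul_of_nonneg_right _ (by positivity)
        exact Real.rpow_le_rpow (abs_nonneg _) (hC x) hp0.le
      · have := hu1.continuous.measurable
        apply Measurable.aestronglyMeasurable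
        fun_prop
    exact (hloc.integrableOn_isCompact (isCompact_closedBall 0 ε)).mono_set ball_subset_closedBall
  have hden : N * (ω * (ρ ^ (p + 1) / (p + 1))) ≤
      ∫ x in ball (0 : E) ε, ‖x‖ ^ (1 - (N : ℝ)) * |u x| ^ p := by
    rw [← hgint, ← hgball]
    apply integral_mono_of_nonneg _ hInt _
    · exact Filter.Eventually.of_forall fun x => by simp only [hg, Pi.zero_apply]; positivity
    · refine Filter.Eventually.of_forall fun x => ?_
      simp only [hg]
      apply mul_le_mul_of_nonneg_left _ (by positivity)
      apply Real.rpow_le_rpow (by positivity) _ hp0.le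
      rw [abs_of_nonneg (hu5 x)]
      exact max_le (hu6 x) (hu5 x)
  have hbdd : BddBelow {R : ℝ | ∃ u : E → ℝ,
        ContDiff ℝ 1 u ∧ HasCompactSupport u ∧
        tsupport u ⊆ ball (0 : E) ε ∧ u ≠ 0 ∧
        R = (∫ x in ball (0 : E) ε, ‖fderiv ℝ u x‖ ^ p) /
            (∫ x in ball (0 : E) ε, ‖x‖ ^ (1 - (N : ℝ)) * |u x| ^ p)} := by
    refine ⟨0, ?_⟩
    rintro R ⟨v, -, -, -, -, rfl⟩
    apply div_nonneg <;> exact integral_nonneg fun x => by positivity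
  refine (csInf_le hbdd ⟨u, hu1, hu2, hu3, ?_, rfl⟩).trans ?_
  · intro h
    have := hu6 0
    simp [h] at this
    linarith
  have hpi := aux_pi p hp
  calc _ ≤ (ε ^ N * ω) / (N * (ω * (ρ ^ (p + 1) / (p + 1)))) :=
        div_le_div₀ (by positivity) hnum (by positivity) hden
    _ ≤ 2 ^ p * ε ^ ((N : ℝ) - 1 - p) := by
        have e : ε ^ N = ε ^ ((N : ℝ) - 1 - p) * ε ^ (p + 1) := by
          rw [← Real.rpow_add hε, ← Real.rpow_natCast]
          congr 1
          ring
        rw [div_le_iff₀ (by positivity), e]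
        have h1 : (1:ℝ) ≤ N := by exact_mod_cast hN
        have e2 : ε ^ (p + 1) = 2 ^ p * (ρ ^ (p + 1) / (p + 1)) := by
          field_simp
          linarith
        rw [e2]
        have h0 : 0 ≤ ε ^ ((N : ℝ) - 1 - p) * (2 ^ p * (ρ ^ (p + 1) / (p + 1))) * ω := by
          positivity
        nlinarith [mul_le_mul_of_nonneg_right h1 h0]
    _ ≤ _ := by
        apply mul_le_mul_of_nonneg_right _ (by positivity)
        apply Real.rpow_le_rpow (by norm_num) _ hp0.le
        linarith
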